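/- Let Θ₀ = {R₀, M₀, N₀, L₀} satisfy the SLS constraints for the true plant (Z, e₁, gᵀ) with R₀ invertible as a rational matrix, let K₀ = L₀ − M₀R₀⁻¹N₀ be its induced controller, and let g̃ ∈ ℝ^{r−1} satisfy ‖δ‖₂ ≤ ε with δ := g − g̃ and ε < 1/(2‖N₀‖). Then: (a) α₀ := (1 − 2ε‖N₀‖)⁻¹ · ‖[1 + gᵀN₀; L₀]‖ is strictly positive; (b) K₀ internally stabilizes the estimated plant (Z, e₁, g̃ᵀ) and achieves on it the closed-loop response Θ̂₀ given by R̂₀ = (I + N₀δᵀ)⁻¹R₀, M̂₀ = M₀ − L₀δᵀ(I + N₀δᵀ)⁻¹R₀, N̂₀ = (I + N₀δᵀ)⁻¹N₀, L̂₀ = L₀ − L₀δᵀ(I + N₀δᵀ)⁻¹N₀; and (c) the pair (Θ̂₀, α₀) is a feasible point of the robust SLS problem for g̃ with uncertainty parameter ε, i.e., Θ̂₀ satisfies the SLS constraints for (Z, e₁, g̃ᵀ) and εα₀‖N̂₀‖ + ‖[1 + g̃ᵀN̂₀; L̂₀]‖ ≤ α₀. -/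

import Mathlib

/- Preliminaries: transfer functions as real rational functions, RH∞, H∞ norms,
   System-Level Synthesis (SLS) constraints, controllers, closed-loop responses,
   coarse-grained identification, Gaussian vectors. -/

noncomputable section
open scoped Matrix BigOperators ENNReal
open MeasureTheory ProbabilityTheory Polynomial

namespace SLS

/-- Scalar transfer functions: real rational functions in `z`. -/
abbrev TF : Type := RatFunc ℝ

/-- Transfer matrices. -/
abbrev TMat (m n : ℕ) : Type := Matrix (Fin m) (Fin n) TF

/-- Embed a real matrix as a (constant) transfer matrix. -/
def rmap {m n : ℕ} (A : Matrix (Fin m) (Fin n) ℝ) : TMat m n := A.map RatFunc.C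

/-- Evaluate a scalar transfer function at a complex point. -/
def evalTF (f : TF) (z : ℂ) : ℂ :=
  (f.num.map (algebraMap ℝ ℂ)).eval z / (f.denom.map (algebraMap ℝ ℂ)).eval z

/-- Evaluate a transfer matrix at a complex point. -/
def evalMat {m n : ℕ} (F : TMat m n) (z : ℂ) : Matrix (Fin m) (Fin n) ℂ :=
  Matrix.of fun i j => evalTF (F i j) z

/-- Spectral norm (ℓ2 → ℓ2 operator norm) of a matrix over `ℝ` or `ℂ`. -/
def specNorm {𝕜 : Type} [RCLike 𝕜] {m n : ℕ} (M : Matrix (Fin m) (Fin n) 𝕜) : ℝ :=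
  ‖LinearMap.toContinuousLinearMap (Matrix.toEuclideanLin M)‖

/-- H∞ norm of a transfer matrix: sup over the unit circle of the spectral norm. -/
def hinfNorm {m n : ℕ} (F : TMat m n) : ℝ :=
  sSup {x : ℝ | ∃ z : ℂ, ‖z‖ = 1 ∧ x = specNorm (evalMat F z)}

/-- H∞ norm of a scalar transfer function. -/
def hinfNormTF (f : TF) : ℝ :=
  sSup {x : ℝ | ∃ z : ℂ, ‖z‖ = 1 ∧ x = ‖evalTF f z‖}

/-- A scalar transfer function is proper if its numerator degree does not exceed
its denominator degree. -/
def ProperTF (f : TF) : Prop := f.num.degree ≤ f.denom.degree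

/-- Strictly proper: vanishes at `z = ∞`. -/
def StrictlyProperTF (f : TF) : Prop := f.num.degree < f.denom.degree

/-- Stable: all poles lie strictly inside the open unit disk. -/
def StableTF (f : TF) : Prop :=
  ∀ z : ℂ, (f.denom.map (algebraMap ℝ ℂ)).eval z = 0 → ‖z‖ < 1

/-- Membership in RH∞ for scalar transfer functions: proper and stable. -/
def MemRHinfTF (f : TF) : Prop := ProperTF f ∧ StableTF f

/-- Membership in RH∞ for transfer matrices (entrywise). -/
def MemRHinf {m n : ℕ} (F : TMat m n) : Prop := ∀ i j, MemRHinfTF (F i j)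

/-- Strict properness of a transfer matrix (entrywise). -/
def StrictlyProper {m n : ℕ} (F : TMat m n) : Prop := ∀ i j, StrictlyProperTF (F i j)

/-- The transfer matrix `zI - A` for a real matrix `A`. -/
def zIA {n : ℕ} (A : Matrix (Fin n) (Fin n) ℝ) : TMat n n :=
  Matrix.diagonal (fun _ => (RatFunc.X : TF)) - rmap A

/-- A system response `Θ = {R, M, N, L}` for a plant with `n` states, `p` control
inputs and `q` measured outputs. -/
structure Response (n p q : ℕ) where
  R : TMat n n
  M : TMat p n
  N : TMat n q
  L : TMat p q

/-- The stability part of the SLS constraints: `R, M, N` strictly proper in RH∞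
and `L ∈ RH∞`. -/
def SLSStable {n p q : ℕ} (Θ : Response n p q) : Prop :=
  StrictlyProper Θ.R ∧ StrictlyProper Θ.M ∧ StrictlyProper Θ.N ∧
  MemRHinf Θ.R ∧ MemRHinf Θ.M ∧ MemRHinf Θ.N ∧ MemRHinf Θ.L

/-- The SLS constraints for the plant `(A, B₂, C₂)`:
`[zI − A, −B₂]·[[R, N],[M, L]] = [I, 0]`, `[[R, N],[M, L]]·[zI − A; −C₂] = [I; 0]`,
written blockwise, together with the stability conditions. -/
def SLSConstraints {n p q : ℕ} (A : Matrix (Fin n) (Fin n) ℝ)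
    (B₂ : Matrix (Fin n) (Fin p) ℝ) (C₂ : Matrix (Fin q) (Fin n) ℝ)
    (Θ : Response n p q) : Prop :=
  zIA A * Θ.R - rmap B₂ * Θ.M = 1 ∧
  zIA A * Θ.N - rmap B₂ * Θ.L = 0 ∧
  Θ.R * zIA A - Θ.N * rmap C₂ = 1 ∧
  Θ.M * zIA A - Θ.L * rmap C₂ = 0 ∧
  SLSStable Θ

/-- The robust SLS constraints with perturbations `(Δ₁, Δ₂)`: the second block
equation becomes `[[R, N],[M, L]]·[zI − A; −C₂] = [I + Δ₁; Δ₂]`. -/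
def RobustSLSConstraints {n p q : ℕ} (A : Matrix (Fin n) (Fin n) ℝ)
    (B₂ : Matrix (Fin n) (Fin p) ℝ) (C₂ : Matrix (Fin q) (Fin n) ℝ)
    (Δ₁ : TMat n n) (Δ₂ : TMat p n) (Θ : Response n p q) : Prop :=
  zIA A * Θ.R - rmap B₂ * Θ.M = 1 ∧
  zIA A * Θ.N - rmap B₂ * Θ.L = 0 ∧
  Θ.R * zIA A - Θ.N * rmap C₂ = 1 + Δ₁ ∧
  Θ.M * zIA A - Θ.L * rmap C₂ = Δ₂ ∧
  SLSStable Θ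

/-- The controller `K = L − M R⁻¹ N` induced by a system response. -/
def controller {n p q : ℕ} (Θ : Response n p q) : TMat p q :=
  Θ.L - Θ.M * Θ.R⁻¹ * Θ.N

/-- `K` achieves the closed-loop response `Θ'` on the plant `(A, B₂, C₂)`: in the
feedback loop `x = (zI − A)⁻¹(B₂u + δx)`, `y = C₂x + δy`, `u = Ky`, the transfer
matrices from `(δx, δy)` to `(x, u)` equal `[[R', N'],[M', L']]`. -/
def Achieves {n p q : ℕ} (A : Matrix (Fin n) (Fin n) ℝ)
    (B₂ : Matrix (Fin n) (Fin p) ℝ) (C₂ : Matrix (Fin q) (Fin n) ℝ)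
    (K : TMat p q) (Θ' : Response n p q) : Prop :=
  zIA A * Θ'.R = rmap B₂ * Θ'.M + 1 ∧
  zIA A * Θ'.N = rmap B₂ * Θ'.L ∧
  Θ'.M = K * rmap C₂ * Θ'.R ∧
  Θ'.L = K * rmap C₂ * Θ'.N + K

/-- `K` internally stabilizes the plant `(A, B₂, C₂)`: the four closed-loop
transfer matrices exist, `R', M', N'` are strictly proper, and all four lie in RH∞. -/
def InternallyStabilizes {n p q : ℕ} (A : Matrix (Fin n) (Fin n) ℝ)
    (B₂ : Matrix (Fin n) (Fin p) ℝ) (C₂ : Matrix (Fin q) (Fin n) ℝ)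
    (K : TMat p q) : Prop :=
  ∃ Θ' : Response n p q, Achieves A B₂ C₂ K Θ' ∧ SLSStable Θ'

/-! ### FIR SISO plants -/

/-- The down-shift matrix (ones on the subdiagonal). -/
def shiftMat (n : ℕ) : Matrix (Fin n) (Fin n) ℝ :=
  Matrix.of fun i j => if (i : ℕ) = (j : ℕ) + 1 then 1 else 0

/-- The first standard basis vector, as a column matrix. -/
def e1 (n : ℕ) : Matrix (Fin n) (Fin 1) ℝ :=
  Matrix.of fun i _ => if (i : ℕ) = 0 then 1 else 0

/-- A vector as a row matrix (`gᵀ`). -/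
def rowVec {n : ℕ} (g : Fin n → ℝ) : Matrix (Fin 1) (Fin n) ℝ :=
  Matrix.of fun _ j => g j

/-- The matrix `C₁ = [gᵀ; 0]`. -/
def C1mat {n : ℕ} (g : Fin n → ℝ) : Matrix (Fin 2) (Fin n) ℝ :=
  Matrix.of fun i j => if (i : ℕ) = 0 then g j else 0

/-- The matrix `D₁₂ = [0; 1]`. -/
def D12mat : Matrix (Fin 2) (Fin 1) ℝ :=
  Matrix.of fun i _ => if (i : ℕ) = 1 then 1 else 0

/-- Stack two scalar transfer functions into a 2×1 transfer matrix `[a; b]`. -/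
def col2 (a b : TF) : TMat 2 1 :=
  Matrix.of fun i _ => if (i : ℕ) = 0 then a else b

/-- The H∞ cost `J(g, Θ) = ‖[C₁, D₁₂]·[[R, N],[M, L]]·[B₁; D₂₁] + D₁₁‖` of a
system response for the generalized plant built from FIR coefficients `g`. -/
def cost {n nw : ℕ} (g : Fin n → ℝ) (B₁ : Matrix (Fin n) (Fin nw) ℝ)
    (D₂₁ : Matrix (Fin 1) (Fin nw) ℝ) (D₁₁ : Matrix (Fin 2) (Fin nw) ℝ)
    (Θ : Response n 1 1) : ℝ :=
  hinfNorm ((rmap (C1mat g) * Θ.R + rmap D12mat * Θ.M) * rmap B₁ +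
    (rmap (C1mat g) * Θ.N + rmap D12mat * Θ.L) * rmap D₂₁ + rmap D₁₁)

/-- The transfer matrix `[1 + g̃ᵀÑ; L̃]` and its H∞ norm. -/
def perfWeight {n : ℕ} (g : Fin n → ℝ) (Θ : Response n 1 1) : ℝ :=
  hinfNorm (col2 (1 + (rmap (rowVec g) * Θ.N) 0 0) (Θ.L 0 0))

/-- The robust SLS objective `Q(g̃, Θ̃, α) = J(g̃, Θ̃) + εα‖R̃B₁ + ÑD₂₁‖`. -/
def Qval {n nw : ℕ} (g : Fin n → ℝ) (B₁ : Matrix (Fin n) (Fin nw) ℝ)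
    (D₂₁ : Matrix (Fin 1) (Fin nw) ℝ) (D₁₁ : Matrix (Fin 2) (Fin nw) ℝ)
    (ε : ℝ) (Θ : Response n 1 1) (α : ℝ) : ℝ :=
  cost g B₁ D₂₁ D₁₁ Θ + ε * α * hinfNorm (Θ.R * rmap B₁ + Θ.N * rmap D₂₁)

/-- Feasibility for the robust SLS problem for the estimate `g̃` with uncertainty
parameter `ε`: `α > 0`, `Θ̃` satisfies the SLS constraints for `(Z, e₁, g̃ᵀ)`, and
`εα‖Ñ‖ + ‖[1 + g̃ᵀÑ; L̃]‖ ≤ α`. -/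
def RobustFeasible {n : ℕ} (g : Fin n → ℝ) (ε : ℝ) (Θ : Response n 1 1) (α : ℝ) : Prop :=
  0 < α ∧ SLSConstraints (shiftMat n) (e1 n) (rowVec g) Θ ∧
  ε * α * hinfNorm Θ.N + perfWeight g Θ ≤ α

/-- `(Θ̃, α)` is a minimizer of the robust SLS problem for `g̃`. -/
def RobustOptimal {n nw : ℕ} (g : Fin n → ℝ) (B₁ : Matrix (Fin n) (Fin nw) ℝ)
    (D₂₁ : Matrix (Fin 1) (Fin nw) ℝ) (D₁₁ : Matrix (Fin 2) (Fin nw) ℝ)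
    (ε : ℝ) (Θ : Response n 1 1) (α : ℝ) : Prop :=
  RobustFeasible g ε Θ α ∧
  ∀ Θ' α', RobustFeasible g ε Θ' α' → Qval g B₁ D₂₁ D₁₁ ε Θ α ≤ Qval g B₁ D₂₁ D₁₁ ε Θ' α'

/-- `Θ₀` is a minimizer of `J(g, ·)` over responses satisfying the SLS constraints
for the plant `(Z, e₁, gᵀ)`. -/
def OptimalResponse {n nw : ℕ} (g : Fin n → ℝ) (B₁ : Matrix (Fin n) (Fin nw) ℝ)
    (D₂₁ : Matrix (Fin 1) (Fin nw) ℝ) (D₁₁ : Matrix (Fin 2) (Fin nw) ℝ)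
    (Θ : Response n 1 1) : Prop :=
  SLSConstraints (shiftMat n) (e1 n) (rowVec g) Θ ∧
  ∀ Θ', SLSConstraints (shiftMat n) (e1 n) (rowVec g) Θ' →
    cost g B₁ D₂₁ D₁₁ Θ ≤ cost g B₁ D₂₁ D₁₁ Θ'

/-- The FIR transfer function `G(z) = Σ_{t=1}^{r−1} g_t z^{−t}` for
`g = (g₁, …, g_{r−1})`. -/
def firTF {n : ℕ} (g : Fin n → ℝ) : TF :=
  ∑ t : Fin n, RatFunc.C (g t) * (RatFunc.X)⁻¹ ^ ((t : ℕ) + 1)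

/-- The FIR transfer function `G(z) = Σ_{k=0}^{T−1} g_k z^{−k}` for a full
impulse-response vector `g_{0:T−1}`. -/
def firTF0 {T : ℕ} (g : Fin T → ℝ) : TF :=
  ∑ k : Fin T, RatFunc.C (g k) * (RatFunc.X)⁻¹ ^ (k : ℕ)

/-! ### Coarse-grained identification -/

/-- Euclidean (ℓ2) norm of a finite real vector. -/
def euclNorm {r : ℕ} (x : Fin r → ℝ) : ℝ := Real.sqrt (∑ i, x i ^ 2)

/-- ℓp norm of a finite real vector, `p ∈ [1, ∞]`. -/
def lpNorm {T : ℕ} (p : ℝ≥0∞) (x : Fin T → ℝ) : ℝ :=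
  if p = ∞ then ⨆ i, |x i| else (∑ i, |x i| ^ p.toReal) ^ (1 / p.toReal)

/-- `r^{2/max(p,2)}` as a real number. -/
def rExp (p : ℝ≥0∞) (r : ℕ) : ℝ := (r : ℝ) ^ ((2 / max p 2).toReal)

/-- The T×T lower-triangular Toeplitz matrix whose first column is `u`. -/
def toep {T : ℕ} (u : Fin T → ℝ) : Matrix (Fin T) (Fin T) ℝ :=
  Matrix.of fun i j =>
    if (j : ℕ) ≤ (i : ℕ) then u ⟨(i : ℕ) - (j : ℕ), lt_of_le_of_lt (Nat.sub_le _ _) i.isLt⟩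
    else 0

/-- The stacked input matrix `Z_mat = [Toep(u₁); …; Toep(u_m)]`. -/
def Zmat {T mE : ℕ} (u : Fin mE → Fin T → ℝ) : Matrix (Fin mE × Fin T) (Fin T) ℝ :=
  Matrix.of fun pr j => toep (u pr.1) pr.2 j

/-- `Z_matᵀ Z_mat`. -/
def ZtZ {T mE : ℕ} (u : Fin mE → Fin T → ℝ) : Matrix (Fin T) (Fin T) ℝ :=
  (Zmat u)ᵀ * Zmat u

/-- The least-squares estimate `g̃_{0:T−1} = (Z_matᵀZ_mat)⁻¹Z_matᵀ(y₁; …; y_m)`. -/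
def lsEst {T mE : ℕ} (u : Fin mE → Fin T → ℝ) (y : Fin mE → Fin T → ℝ) : Fin T → ℝ :=
  ((ZtZ u)⁻¹ * (Zmat u)ᵀ).mulVec fun pr => y pr.1 pr.2

/-- Pad the FIR coefficients `g = (g₁, …, g_{r−1})` to the impulse response
`g_{0:T−1} = (0, g₁, …, g_{r−1}, 0, …, 0)`. -/
def pad {r T : ℕ} (_ : r ≤ T) (g : Fin (r - 1) → ℝ) : Fin T → ℝ := fun k =>
  if hk : 1 ≤ (k : ℕ) ∧ (k : ℕ) < r then g ⟨(k : ℕ) - 1, by omega⟩ else 0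

/-- The estimated FIR coefficients `g̃ = (g̃₁, …, g̃_{r−1})` from coarse-grained
identification with true coefficients `g` and additive noise on the outputs. -/
def coarseEst {r T mE : ℕ} (hrT : r ≤ T) (u : Fin mE → Fin T → ℝ)
    (g : Fin (r - 1) → ℝ) (noise : Fin mE → Fin T → ℝ) : Fin (r - 1) → ℝ :=
  fun i =>
    lsEst u (fun k => (toep (u k)).mulVec (pad hrT g) + noise k)
      ⟨(i : ℕ) + 1, by have := i.isLt; omega⟩

/-! ### Gaussian random vectors -/

/-- The standard Gaussian measure on `Fin r → ℝ` (i.i.d. `N(0,1)` coordinates). -/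
def stdGaussianPi (r : ℕ) : Measure (Fin r → ℝ) :=
  Measure.pi fun _ => gaussianReal 0 1

/-- `δ` is a centered Gaussian random vector with covariance `Cov`: its law is the
pushforward of the standard Gaussian under some `A` with `AAᵀ = Cov`. -/
def IsCenteredGaussianVec {Ω : Type} [MeasurableSpace Ω] (P : Measure Ω) {r : ℕ}
    (δ : Ω → Fin r → ℝ) (Cov : Matrix (Fin r) (Fin r) ℝ) : Prop :=
  ∃ A : Matrix (Fin r) (Fin r) ℝ, A * Aᵀ = Cov ∧
    Measure.map δ P = Measure.map (fun x => A.mulVec x) (stdGaussianPi r)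

/-- The law of i.i.d. `N(0, σ²)` noise across `mE` experiments of length `T`. -/
def iidGaussianLaw (mE T : ℕ) (σ2 : ℝ) : Measure (Fin mE → Fin T → ℝ) :=
  Measure.pi fun _ => Measure.pi fun _ => gaussianReal 0 σ2.toNNReal


/-- Scalar multiplication of a transfer matrix by a scalar transfer function. -/
def sMulTF {m n : ℕ} (c : TF) (M : TMat m n) : TMat m n := Matrix.of fun i j => c * M i j

/-- The perturbed response `Θ̂` with `R̂ = (I+Δ₁)⁻¹R̃`, `M̂ = M̃ − Δ₂(I+Δ₁)⁻¹R̃`,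
`N̂ = (I+Δ₁)⁻¹Ñ`, `L̂ = L̃ − Δ₂(I+Δ₁)⁻¹Ñ` (with the rational matrix inverse). -/
def deltaPerturb {n p q : ℕ} (Δ₁ : TMat n n) (Δ₂ : TMat p n) (Θ : Response n p q) :
    Response n p q where
  R := (1 + Δ₁)⁻¹ * Θ.R
  M := Θ.M - Δ₂ * ((1 + Δ₁)⁻¹ * Θ.R)
  N := (1 + Δ₁)⁻¹ * Θ.N
  L := Θ.L - Δ₂ * ((1 + Δ₁)⁻¹ * Θ.N)

/-- The Sherman–Morrison form of the perturbed response in the FIR SISO case: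
`[[R̂, N̂],[M̂, L̂]] = [[R̃, Ñ],[M̃, L̃]] + (1 − δᵀÑ)⁻¹·[Ñδᵀ; L̃δᵀ]·[R̃, Ñ]`. -/
def smPerturb {n : ℕ} (δ : Fin n → ℝ) (Θ : Response n 1 1) : Response n 1 1 where
  R := Θ.R + sMulTF (1 - (rmap (rowVec δ) * Θ.N) 0 0)⁻¹ (Θ.N * rmap (rowVec δ) * Θ.R)
  M := Θ.M + sMulTF (1 - (rmap (rowVec δ) * Θ.N) 0 0)⁻¹ (Θ.L * rmap (rowVec δ) * Θ.R)
  N := Θ.N + sMulTF (1 - (rmap (rowVec δ) * Θ.N) 0 0)⁻¹ (Θ.N * rmap (rowVec δ) * Θ.N)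
  L := Θ.L + sMulTF (1 - (rmap (rowVec δ) * Θ.N) 0 0)⁻¹ (Θ.L * rmap (rowVec δ) * Θ.N)

/-- The block-diagonal matrix with `m` copies of `Toep(g)` on the diagonal
(the action of `Toep(g)` on the stacked process noise of `m` experiments). -/
def bigToep {T mE : ℕ} (g : Fin T → ℝ) : Matrix (Fin mE × Fin T) (Fin mE × Fin T) ℝ :=
  Matrix.of fun pr qr => if pr.1 = qr.1 then toep g pr.2 qr.2 else 0

end SLS

open SLS

namespace SLSAux

theorem evalTF_eq (f : TF) (z : ℂ) : evalTF f z = RatFunc.eval (algebraMap ℝ ℂ) z f := by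
  simp [evalTF, RatFunc.eval, Polynomial.eval_map]

theorem stable_iff (f : TF) : StableTF f ↔
    ∀ z : ℂ, 1 ≤ ‖z‖ → Polynomial.eval₂ (algebraMap ℝ ℂ) z f.denom ≠ 0 := by
  simp only [StableTF, Polynomial.eval_map]
  exact ⟨fun h z hz h0 => absurd (h z h0) (not_lt.2 hz),
    fun h z h0 => by by_contra hz; exact h z (not_lt.1 hz) h0⟩

theorem stable_of_dvd {f : TF} {q : ℝ[X]} (hq : f.denom ∣ q)
    (h : ∀ z : ℂ, 1 ≤ ‖z‖ → Polynomial.eval₂ (algebraMap ℝ ℂ) z q ≠ 0) : StableTF f := by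
  rw [stable_iff]
  intro z hz h0
  exact h z hz (Polynomial.eval₂_eq_zero_of_dvd_of_eval₂_eq_zero _ z hq h0)

theorem stable_C (c : ℝ) : StableTF (RatFunc.C c) := by
  rw [stable_iff]; intro z _; simp

theorem stable_add {f g : TF} (hf : StableTF f) (hg : StableTF g) : StableTF (f + g) := by
  rw [stable_iff] at hf hg
  refine stable_of_dvd (RatFunc.denom_add_dvd f g) fun z hz => ?_
  rw [Polynomial.eval₂_mul]
  exact mul_ne_zero (hf z hz) (hg z hz)

theorem stable_mul {f g : TF} (hf : StableTF f) (hg : StableTF g) : StableTF (f * g) := by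
  rw [stable_iff] at hf hg
  refine stable_of_dvd (RatFunc.denom_mul_dvd f g) fun z hz => ?_
  rw [Polynomial.eval₂_mul]
  exact mul_ne_zero (hf z hz) (hg z hz)

/-- Stable transfer functions form a subring. -/
def stab : Subring TF where
  carrier := {f | StableTF f}
  mul_mem' := stable_mul
  one_mem' := by simpa using stable_C 1
  add_mem' := stable_add
  zero_mem' := by simpa using stable_C 0
  neg_mem' := by
    intro f hf
    have := stable_mul (stable_C (-1)) hf
    simpa using this

theorem mem_stab {f : TF} : f ∈ stab ↔ StableTF f := Iff.rfl

theorem eval_add {f g : TF} (hf : StableTF f) (hg : StableTF g) {z : ℂ} (hz : 1 ≤ ‖z‖) :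
    evalTF (f + g) z = evalTF f z + evalTF g z := by
  simp only [evalTF_eq]
  exact RatFunc.eval_add _ _ ((stable_iff f).1 hf z hz) ((stable_iff g).1 hg z hz)

theorem eval_mul {f g : TF} (hf : StableTF f) (hg : StableTF g) {z : ℂ} (hz : 1 ≤ ‖z‖) :
    evalTF (f * g) z = evalTF f z * evalTF g z := by
  simp only [evalTF_eq]
  exact RatFunc.eval_mul _ _ ((stable_iff f).1 hf z hz) ((stable_iff g).1 hg z hz)

theorem eval_C (c : ℝ) (z : ℂ) : evalTF (RatFunc.C c) z = c := by
  simp [evalTF_eq]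

theorem eval_one (z : ℂ) : evalTF 1 z = 1 := by
  simp [evalTF_eq]

theorem eval_sum {ι : Type} (s : Finset ι) (f : ι → TF) (hf : ∀ i, StableTF (f i))
    {z : ℂ} (hz : 1 ≤ ‖z‖) : evalTF (∑ i ∈ s, f i) z = ∑ i ∈ s, evalTF (f i) z := by
  classical
  induction s using Finset.induction_on with
  | empty => simp [evalTF_eq]
  | insert a s ha ih =>
    rw [Finset.sum_insert ha, Finset.sum_insert ha, eval_add (hf a) _ hz, ih]
    exact stab.sum_mem fun i _ => hf i

open Classical in
/-- valuation at infinity -/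
def vv : Valuation TF (WithZero (Multiplicative ℤ)) := RatFunc.inftyValuation ℝ

theorem vv_ne {f : TF} (hf : f ≠ 0) : vv f = WithZero.exp f.intDegree := by
  classical
  exact RatFunc.inftyValuation_of_nonzero ℝ hf

theorem proper_iff (f : TF) : ProperTF f ↔ vv f ≤ 1 := by
  by_cases hf : f = 0
  · subst hf; simp [ProperTF]
  · rw [vv_ne hf, ProperTF, Polynomial.degree_eq_natDegree (RatFunc.num_ne_zero hf),
      Polynomial.degree_eq_natDegree (RatFunc.denom_ne_zero f), ← WithZero.exp_zero,
      WithZero.exp_le_exp, RatFunc.intDegree, Nat.cast_le]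
    omega

theorem sproper_iff (f : TF) : StrictlyProperTF f ↔ vv f < 1 := by
  by_cases hf : f = 0
  · subst hf; simp [StrictlyProperTF]
  · rw [vv_ne hf, StrictlyProperTF, Polynomial.degree_eq_natDegree (RatFunc.num_ne_zero hf),
      Polynomial.degree_eq_natDegree (RatFunc.denom_ne_zero f), ← WithZero.exp_zero,
      WithZero.exp_lt_exp, RatFunc.intDegree, Nat.cast_lt]
    omega

/-- The ring RH∞. -/
def RH : Subring TF := stab ⊓ vv.integer

theorem mem_RH {f : TF} : f ∈ RH ↔ MemRHinfTF f := by
  rw [RH, Subring.mem_inf, Valuation.mem_integer_iff, mem_stab, MemRHinfTF, proper_iff]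
  exact and_comm

/-- strictly proper elements of RH∞. -/
def SP (f : TF) : Prop := f ∈ RH ∧ vv f < 1

theorem RH_stable {f : TF} (h : f ∈ RH) : StableTF f := (mem_RH.1 h).2

theorem C_RH (c : ℝ) : RatFunc.C c ∈ RH := by
  refine ⟨stable_C c, ?_⟩
  change vv _ ≤ 1
  rw [← proper_iff, ProperTF]
  simpa using Polynomial.degree_C_le

theorem SP_add {f g : TF} (hf : SP f) (hg : SP g) : SP (f + g) :=
  ⟨RH.add_mem hf.1 hg.1, vv.map_add_lt hf.2 hg.2⟩

theorem RH_le {f : TF} (hf : f ∈ RH) : vv f ≤ 1 := hf.2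

theorem SP_mul {f g : TF} (hf : f ∈ RH) (hg : SP g) : SP (f * g) := by
  refine ⟨RH.mul_mem hf hg.1, ?_⟩
  rw [map_mul]
  exact mul_lt_one_of_nonneg_of_lt_one_right (RH_le hf) zero_le hg.2

theorem SP_sub {f g : TF} (hf : SP f) (hg : SP g) : SP (f - g) :=
  ⟨RH.sub_mem hf.1 hg.1, vv.map_sub_lt hf.2 hg.2⟩

theorem SP_sum {ι : Type} (s : Finset ι) (f : ι → TF) (hf : ∀ i, SP (f i)) :
    SP (∑ i ∈ s, f i) :=
  ⟨RH.sum_mem fun i _ => (hf i).1, vv.map_sum_lt one_ne_zero fun i _ => (hf i).2⟩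

theorem differentiable_evalTF {f : TF} (hf : StableTF f) {z : ℂ} (hz : 1 ≤ ‖z‖) :
    DifferentiableAt ℂ (evalTF f) z := by
  have h := (stable_iff f).1 hf z hz
  rw [← Polynomial.eval_map] at h
  unfold evalTF
  exact DifferentiableAt.div (Polynomial.differentiableAt _) (Polynomial.differentiableAt _) h

/-- maximum modulus outside the disk -/
theorem max_mod {f : TF} (hf : SP f) {c : ℝ} (hc : 0 < c)
    (h : ∀ z : ℂ, ‖z‖ = 1 → ‖evalTF f z‖ ≤ c) (z : ℂ) (hz : 1 ≤ ‖z‖) : ‖evalTF f z‖ ≤ c := by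
  have hst := RH_stable hf.1
  have hdeg : (f.num.map (algebraMap ℝ ℂ)).degree < (f.denom.map (algebraMap ℝ ℂ)).degree := by
    rw [Polynomial.degree_map, Polynomial.degree_map]
    exact (sproper_iff f).2 hf.2
  have ho := (Polynomial.isLittleO_cobounded_of_degree_lt hdeg).bound hc
  rw [← comap_norm_atTop, Filter.eventually_comap, Filter.eventually_atTop] at ho
  obtain ⟨ρ, hρ⟩ := ho
  have key : ∀ w : ℂ, 1 ≤ ‖w‖ → ρ ≤ ‖w‖ → ‖evalTF f w‖ ≤ c := by
    intro w hw hw'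
    have h1 := hρ _ hw' w rfl
    have h2 := (stable_iff f).1 hst w hw
    rw [← Polynomial.eval_map] at h2
    rw [evalTF, norm_div, div_le_iff₀ (norm_pos_iff.2 h2)]
    exact h1
  by_cases hzρ : ρ ≤ ‖z‖
  · exact key z hz hzρ
  rcases hz.eq_or_lt with hz1 | hz1
  · exact h z hz1.symm
  push Not at hzρ
  let U : Set ℂ := {w | 1 < ‖w‖ ∧ ‖w‖ < ρ}
  have hUo : IsOpen U := (isOpen_lt continuous_const continuous_norm).inter
    (isOpen_lt continuous_norm continuous_const)
  have hcl : closure U ⊆ {w | 1 ≤ ‖w‖ ∧ ‖w‖ ≤ ρ} := by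
    apply closure_minimal
    · intro w hw; exact ⟨hw.1.le, hw.2.le⟩
    · exact (isClosed_le continuous_const continuous_norm).inter
        (isClosed_le continuous_norm continuous_const)
  have hbdd : Bornology.IsBounded U := by
    apply (Metric.isBounded_closedBall (x := (0:ℂ)) (r := ρ)).subset
    intro w hw
    simpa using hw.2.le
  refine Complex.norm_le_of_forall_mem_frontier_norm_le hbdd (f := evalTF f) ?_ ?_
    (subset_closure (show z ∈ U from ⟨hz1, hzρ⟩))
  · apply DifferentiableOn.diffContOnCl
    intro w hw
    exact (differentiable_evalTF hst (hcl hw).1).differentiableWithinAt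
  · intro w hw
    rw [hUo.frontier_eq] at hw
    have h1 := hcl hw.1
    rcases h1.1.eq_or_lt with h2 | h2
    · exact h w h2.symm
    · refine key w h1.1 ?_
      by_contra h3
      exact hw.2 ⟨h2, not_le.1 h3⟩

theorem inv_RH {s : TF} (hs : SP s) {c : ℝ} (hc : 0 < c) (hc1 : c < 1)
    (h : ∀ z : ℂ, ‖z‖ = 1 → ‖evalTF s z‖ ≤ c) : 1 + s ≠ 0 ∧ (1 + s)⁻¹ ∈ RH := by
  have hv : vv (1 + s) = 1 := by
    have := vv.map_add_eq_of_lt_right (x := s) (y := 1) (by simpa using hs.2)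
    rw [add_comm, this, map_one]
  have h0 : 1 + s ≠ 0 := by
    intro h0; rw [h0] at hv; simp at hv
  have hst := RH_stable hs.1
  refine ⟨h0, ?_, ?_⟩
  · change StableTF _
    refine stable_of_dvd (RatFunc.denom_inv_dvd h0) fun z hz hz0 => ?_
    have h1 : evalTF (1 + s) z = 0 := by
      rw [evalTF_eq, RatFunc.eval, hz0, zero_div]
    rw [eval_add stab.one_mem hst hz, eval_one] at h1
    have h2 := max_mod hs hc h z hz
    have h3 : evalTF s z = -1 := by linear_combination h1
    rw [h3] at h2
    simp at h2
    linarith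
  · change vv _ ≤ 1
    rw [map_inv₀, hv, inv_one]

theorem eval_inv {f : TF} (hf : StableTF f) (hi : StableTF f⁻¹) (h0 : f ≠ 0) {z : ℂ}
    (hz : 1 ≤ ‖z‖) : evalTF f⁻¹ z = (evalTF f z)⁻¹ := by
  have := eval_mul hf hi hz
  rw [mul_inv_cancel₀ h0, eval_one] at this
  exact eq_inv_of_mul_eq_one_right this.symm

/-! norms -/

theorem specNorm_col {n : ℕ} (M : Matrix (Fin n) (Fin 1) ℂ) :
    specNorm M = Real.sqrt (∑ i, ‖M i 0‖ ^ 2) := by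
  have key : ∀ x : EuclideanSpace ℂ (Fin 1), ‖Matrix.toEuclideanLin M x‖ =
      Real.sqrt (∑ i, ‖M i 0‖ ^ 2) * ‖x‖ := by
    intro x
    rw [EuclideanSpace.norm_eq, EuclideanSpace.norm_eq, ← Real.sqrt_mul (by positivity)]
    congr 1
    simp [Matrix.toLpLin_apply, Matrix.mulVec, dotProduct, Finset.sum_mul, mul_pow]
  apply le_antisymm
  · refine ContinuousLinearMap.opNorm_le_bound _ (Real.sqrt_nonneg _) fun x => ?_
    exact (key x).le
  · have h := ContinuousLinearMap.le_opNorm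
      (LinearMap.toContinuousLinearMap (Matrix.toEuclideanLin M)) (EuclideanSpace.single 0 1)
    have h2 := key (EuclideanSpace.single 0 1)
    simp only [PiLp.norm_single, norm_one, mul_one] at h h2
    rw [← h2]
    exact h

theorem specNorm_smul {n : ℕ} (c : ℂ) (M M' : Matrix (Fin n) (Fin 1) ℂ)
    (h : ∀ i, M' i 0 = c * M i 0) : specNorm M' = ‖c‖ * specNorm M := by
  rw [specNorm_col, specNorm_col, ← Real.sqrt_sq (norm_nonneg c), ← Real.sqrt_mul (by positivity),
    Finset.mul_sum]
  simp [h, mul_pow]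

theorem entry_le {n : ℕ} (M : Matrix (Fin n) (Fin 1) ℂ) (i : Fin n) : ‖M i 0‖ ≤ specNorm M := by
  rw [specNorm_col]
  apply Real.le_sqrt_of_sq_le
  exact Finset.single_le_sum (f := fun i => ‖M i 0‖ ^ 2) (fun _ _ => by positivity)
    (Finset.mem_univ i)

theorem dot_le {n : ℕ} (d : Fin n → ℝ) (M : Matrix (Fin n) (Fin 1) ℂ) :
    ‖∑ i, (d i : ℂ) * M i 0‖ ≤ euclNorm d * specNorm M := by
  rw [specNorm_col, euclNorm]
  refine (norm_sum_le _ _).trans ?_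
  have := Real.sum_mul_le_sqrt_mul_sqrt Finset.univ (fun i => ‖d i‖) (fun i => ‖M i 0‖)
  simpa using this

theorem bdd {n : ℕ} {F : TMat n 1} (hF : ∀ i, StableTF (F i 0)) :
    BddAbove {x : ℝ | ∃ z : ℂ, ‖z‖ = 1 ∧ x = specNorm (evalMat F z)} := by
  have hc : ContinuousOn (fun z : ℂ => specNorm (evalMat F z)) (Metric.sphere 0 1) := by
    simp only [specNorm_col]
    apply Real.continuous_sqrt.comp_continuousOn
    apply continuousOn_finsetSum
    intro i _
    apply ContinuousOn.pow
    apply ContinuousOn.norm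
    intro z hz
    have hz' : ‖z‖ = 1 := by simpa using hz
    exact (differentiable_evalTF (hF i) hz'.ge).continuousAt.continuousWithinAt
  have := (isCompact_sphere (0:ℂ) 1).bddAbove_image hc
  refine this.mono ?_
  rintro x ⟨z, hz, rfl⟩
  exact ⟨z, by simpa using hz, rfl⟩

theorem le_hinf {n : ℕ} {F : TMat n 1} (hF : ∀ i, StableTF (F i 0)) {z : ℂ} (hz : ‖z‖ = 1) :
    specNorm (evalMat F z) ≤ hinfNorm F := le_csSup (bdd hF) ⟨z, hz, rfl⟩

theorem hinf_le {n : ℕ} {F : TMat n 1} {c : ℝ}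
    (h : ∀ z : ℂ, ‖z‖ = 1 → specNorm (evalMat F z) ≤ c) : hinfNorm F ≤ c := by
  apply csSup_le
  · exact ⟨_, 1, by simp, rfl⟩
  · rintro x ⟨z, hz, rfl⟩
    exact h z hz

theorem specNorm_nonneg {n : ℕ} (M : Matrix (Fin n) (Fin 1) ℂ) : 0 ≤ specNorm M := norm_nonneg _

theorem hinf_nonneg {n : ℕ} {F : TMat n 1} (hF : ∀ i, StableTF (F i 0)) : 0 ≤ hinfNorm F :=
  (specNorm_nonneg _).trans (le_hinf hF (z := 1) (by simp))

theorem eq_zero_of_circle {f : TF} (hf : StableTF f)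
    (h : ∀ z : ℂ, ‖z‖ = 1 → evalTF f z = 0) : f = 0 := by
  have h1 : f.num.map (algebraMap ℝ ℂ) = 0 := by
    apply Polynomial.eq_zero_of_infinite_isRoot
    have hinf : (Metric.sphere (0:ℂ) 1).Infinite := by
      have hcon : IsPreconnected (Metric.sphere (0:ℂ) 1) :=
        isPreconnected_sphere (by simp) 0 1
      apply hcon.infinite_of_nontrivial
      refine ⟨1, by simp, -1, by simp, ?_⟩
      intro h; norm_num [Complex.ext_iff] at h
    refine hinf.mono ?_
    intro z hz
    have hz' : ‖z‖ = 1 := by simpa using hz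
    have h2 := (stable_iff f).1 hf z hz'.ge
    rw [← Polynomial.eval_map] at h2
    have h3 := h z hz'
    rw [evalTF, div_eq_zero_iff] at h3
    exact h3.resolve_right h2
  rw [Polynomial.map_eq_zero] at h1
  exact RatFunc.num_eq_zero_iff.1 h1

theorem perf_pos {a b : TF} (ha : SP a) (hb : b ∈ RH) : 0 < hinfNorm (col2 (1 + a) b) := by
  have h1a : 1 + a ∈ RH := RH.add_mem RH.one_mem ha.1
  have hst : ∀ i, StableTF (col2 (1 + a) b i 0) := by
    intro i
    fin_cases i
    · exact RH_stable h1a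
    · exact RH_stable hb
  by_contra hcon
  have h0 : 1 + a = 0 := by
    apply eq_zero_of_circle (RH_stable h1a)
    intro z hz
    have := (entry_le (evalMat (col2 (1 + a) b) z) 0).trans ((le_hinf hst hz).trans (not_lt.1 hcon))
    simpa [evalMat, col2] using this
  have hv : vv a = 1 := by
    rw [eq_neg_of_add_eq_zero_right h0]; simp
  exact ha.2.ne hv

/-! matrices -/

theorem SPmat_mul {a b c : ℕ} {A : TMat a b} {B : TMat b c} (hA : ∀ i j, A i j ∈ RH)
    (hB : ∀ i j, SP (B i j)) (i j) : SP ((A * B) i j) := by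
  rw [Matrix.mul_apply]
  exact SP_sum _ _ fun k => SP_mul (hA i k) (hB k j)

theorem RHmat_mul {a b c : ℕ} {A : TMat a b} {B : TMat b c} (hA : ∀ i j, A i j ∈ RH)
    (hB : ∀ i j, B i j ∈ RH) (i j) : (A * B) i j ∈ RH := by
  rw [Matrix.mul_apply]
  exact RH.sum_mem fun k _ => RH.mul_mem (hA i k) (hB k j)

theorem rmap_RH {a b : ℕ} (A : Matrix (Fin a) (Fin b) ℝ) (i j) : rmap A i j ∈ RH := C_RH _

theorem rmap_sub {n : ℕ} (g gt : Fin n → ℝ) :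
    rmap (rowVec gt) = rmap (rowVec g) - rmap (rowVec (g - gt)) := by
  ext i j
  simp [rmap, rowVec]

theorem mul_one_one {n : ℕ} (N : TMat n 1) (S : TMat 1 1) : N * S = S 0 0 • N := by
  ext i j
  have : j = 0 := Subsingleton.elim _ _
  subst this
  simp [Matrix.mul_apply, mul_comm]

/-- The purely algebraic part: SLS equations and achievability of the perturbed response. -/
theorem algebra_part {n : ℕ} (Z : TMat n n) (B : TMat n 1) (G d : TMat 1 n) (R : TMat n n)
    (M : TMat 1 n) (N : TMat n 1) (L : TMat 1 1)
    (h1 : Z * R - B * M = 1) (h2 : Z * N - B * L = 0) (h3 : R * Z - N * G = 1)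
    (h4 : M * Z - L * G = 0) (hR : IsUnit R.det) (hD : IsUnit (1 + N * d).det)
    (R' : TMat n n) (M' : TMat 1 n) (N' : TMat n 1) (L' : TMat 1 1)
    (hR' : R' = (1 + N * d)⁻¹ * R) (hN' : N' = (1 + N * d)⁻¹ * N)
    (hM' : M' = M - L * d * R') (hL' : L' = L - L * d * N') :
    (Z * R' - B * M' = 1 ∧ Z * N' - B * L' = 0 ∧ R' * Z - N' * (G - d) = 1 ∧
      M' * Z - L' * (G - d) = 0) ∧
    M' = (L - M * R⁻¹ * N) * (G - d) * R' ∧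
    L' = (L - M * R⁻¹ * N) * (G - d) * N' + (L - M * R⁻¹ * N) := by
  have eR : R' = R - N * d * R' := by
    have : (1 + N * d) * R' = R := by rw [hR', Matrix.mul_nonsing_inv_cancel_left _ _ hD]
    rw [Matrix.add_mul, Matrix.one_mul] at this
    exact eq_sub_of_add_eq this
  have eN : N' = N - N * d * N' := by
    have : (1 + N * d) * N' = N := by rw [hN', Matrix.mul_nonsing_inv_cancel_left _ _ hD]
    rw [Matrix.add_mul, Matrix.one_mul] at this
    exact eq_sub_of_add_eq this
  have hBL : B * L = Z * N := (sub_eq_zero.1 h2).symm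
  have hLG : L * G = M * Z := (sub_eq_zero.1 h4).symm
  have hNG : N * G = R * Z - 1 := by rw [← h3]; abel
  have k3 : R' * Z - N' * (G - d) = 1 := by
    have : R' * Z - N' * (G - d) = (1 + N * d)⁻¹ * (1 + N * d) := by
      rw [hR', hN', ← h3]
      simp only [Matrix.mul_sub, Matrix.mul_add, Matrix.mul_assoc]
      abel
    rw [this, Matrix.nonsing_inv_mul _ hD]
  have k1 : Z * R' - B * M' = 1 := by
    rw [hM', Matrix.mul_sub, ← Matrix.mul_assoc, ← Matrix.mul_assoc, hBL]
    nth_rw 1 [eR]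
    rw [← h1]
    simp only [Matrix.mul_sub, Matrix.mul_assoc]
    abel
  have k2 : Z * N' - B * L' = 0 := by
    rw [hL', Matrix.mul_sub, ← Matrix.mul_assoc, ← Matrix.mul_assoc, hBL]
    nth_rw 1 [eN]
    simp only [Matrix.mul_sub, Matrix.mul_assoc]
    abel
  have k4 : M' * Z - L' * (G - d) = 0 := by
    have : M' * Z - L' * (G - d) = M * Z - L * G + L * d - L * d * (R' * Z - N' * (G - d)) := by
      rw [hM', hL']
      simp only [Matrix.mul_sub, Matrix.sub_mul, Matrix.mul_assoc]
      abel
    rw [this, k3, h4, Matrix.mul_one]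
    abel
  -- the controller times the perturbed output matrix
  have hK : (L - M * R⁻¹ * N) * (G - d) = M * R⁻¹ * (1 + N * d) - L * d := by
    have e1 : M * R⁻¹ * (N * G) = M * Z - M * R⁻¹ := by
      rw [hNG, Matrix.mul_sub, Matrix.mul_one, Matrix.mul_assoc M, ← Matrix.mul_assoc R⁻¹,
        Matrix.nonsing_inv_mul _ hR, Matrix.one_mul]
    have e2 : (L - M * R⁻¹ * N) * (G - d) =
        L * G - L * d - M * R⁻¹ * (N * G) + M * R⁻¹ * (N * d) := by
      simp only [Matrix.mul_sub, Matrix.sub_mul, Matrix.mul_assoc]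
      abel
    rw [e2, e1, hLG, Matrix.mul_add, Matrix.mul_one]
    abel
  refine ⟨⟨k1, k2, k3, k4⟩, ?_, ?_⟩
  · rw [hK, Matrix.sub_mul, Matrix.mul_assoc (M * R⁻¹), hM']
    congr 1
    rw [hR', Matrix.mul_nonsing_inv_cancel_left _ _ hD, Matrix.mul_assoc,
      Matrix.nonsing_inv_mul _ hR, Matrix.mul_one]
  · rw [hK, Matrix.sub_mul, Matrix.mul_assoc (M * R⁻¹), hL']
    nth_rw 2 [hN']
    rw [Matrix.mul_nonsing_inv_cancel_left _ _ hD]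
    abel

theorem main {n : ℕ} (g gt : Fin n → ℝ) (Θ₀ : Response n 1 1) (ε : ℝ)
    (hsls : SLSConstraints (shiftMat n) (e1 n) (rowVec g) Θ₀)
    (hR : IsUnit Θ₀.R.det)
    (hδ : euclNorm (g - gt) ≤ ε)
    (hε : ε < 1 / (2 * hinfNorm Θ₀.N)) (Θ : Response n 1 1)
    (hΘ : Θ = deltaPerturb (Θ₀.N * rmap (rowVec (g - gt))) (Θ₀.L * rmap (rowVec (g - gt))) Θ₀) :
    0 < (1 - 2 * ε * hinfNorm Θ₀.N)⁻¹ * perfWeight g Θ₀ ∧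
    (InternallyStabilizes (shiftMat n) (e1 n) (rowVec gt) (controller Θ₀) ∧
      Achieves (shiftMat n) (e1 n) (rowVec gt) (controller Θ₀) Θ) ∧
    SLSConstraints (shiftMat n) (e1 n) (rowVec gt) Θ ∧
    ε * ((1 - 2 * ε * hinfNorm Θ₀.N)⁻¹ * perfWeight g Θ₀) * hinfNorm Θ.N + perfWeight gt Θ ≤
      (1 - 2 * ε * hinfNorm Θ₀.N)⁻¹ * perfWeight g Θ₀ := by
  obtain ⟨R, M, N, L⟩ := Θ₀
  obtain ⟨R', M', N', L'⟩ := Θ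
  obtain ⟨h1, h2, h3, h4, hsR, hsM, hsN, hrR, hrM, hrN, hrL⟩ := hsls
  simp only [deltaPerturb, Response.mk.injEq] at *
  obtain ⟨hR', hM', hN', hL'⟩ := hΘ
  have hgt := rmap_sub g gt
  set d := rmap (rowVec (g - gt)) with hd
  -- memberships
  have mR : ∀ i j, SP (R i j) := fun i j => ⟨mem_RH.2 (hrR i j), (sproper_iff _).1 (hsR i j)⟩
  have mM : ∀ i j, SP (M i j) := fun i j => ⟨mem_RH.2 (hrM i j), (sproper_iff _).1 (hsM i j)⟩
  have mN : ∀ i j, SP (N i j) := fun i j => ⟨mem_RH.2 (hrN i j), (sproper_iff _).1 (hsN i j)⟩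
  have mL : ∀ i j, L i j ∈ RH := fun i j => mem_RH.2 (hrL i j)
  have md : ∀ i j, d i j ∈ RH := rmap_RH _
  have sN : ∀ i, StableTF (N i 0) := fun i => RH_stable (mN i 0).1
  -- scalars
  have hε0 : 0 ≤ ε := (Real.sqrt_nonneg _).trans hδ
  have hN0 : 0 ≤ hinfNorm N := hinf_nonneg sN
  have hNpos : 0 < hinfNorm N := by
    rcases hN0.eq_or_lt with h | h
    · rw [← h] at hε; simp at hε; linarith
    · exact h
  have ht : 2 * (ε * hinfNorm N) < 1 := by
    rw [lt_div_iff₀ (by positivity)] at hε; linarith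
  have ht0 : 0 ≤ ε * hinfNorm N := by positivity
  obtain ⟨s, hs⟩ : ∃ s, s = (d * N) 0 0 := ⟨_, rfl⟩
  have hsSP : SP s := hs ▸ SPmat_mul md mN 0 0
  have dotEval : ∀ (a : Fin n → ℝ) {z : ℂ}, ‖z‖ = 1 → evalTF ((rmap (rowVec a) * N) 0 0) z =
      ∑ i, (a i : ℂ) * evalMat N z i 0 := by
    intro a z hz
    rw [Matrix.mul_apply, eval_sum _ _ _ hz.ge]
    · refine Finset.sum_congr rfl fun i _ => ?_
      rw [eval_mul (RH_stable (rmap_RH _ _ _)) (sN i) hz.ge]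
      simp [rmap, rowVec, eval_C, evalMat]
    · intro i
      exact stable_mul (RH_stable (rmap_RH _ _ _)) (sN i)
  have hsb : ∀ z : ℂ, ‖z‖ = 1 → ‖evalTF s z‖ ≤ ε * hinfNorm N := by
    intro z hz
    rw [hs, hd, dotEval _ hz]
    exact (dot_le _ _).trans (mul_le_mul hδ (le_hinf sN hz) (specNorm_nonneg _) hε0)
  obtain ⟨h0, hcRH⟩ := inv_RH hsSP (c := 1 / 2) (by norm_num) (by norm_num)
    (fun z hz => (hsb z hz).trans (by linarith))
  obtain ⟨c, hc⟩ : ∃ c, c = (1 + s)⁻¹ := ⟨_, rfl⟩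
  rw [← hc] at hcRH
  have hcs : c * (1 + s) = 1 := by rw [hc, inv_mul_cancel₀ h0]
  have hcb : ∀ z : ℂ, ‖z‖ = 1 → ‖evalTF c z‖ ≤ (1 - ε * hinfNorm N)⁻¹ := by
    intro z hz
    have h1s : 1 + s ∈ RH := RH.add_mem RH.one_mem hsSP.1
    rw [hc, eval_inv (RH_stable h1s) (hc ▸ RH_stable hcRH) h0 hz.ge,
      eval_add stab.one_mem (RH_stable hsSP.1) hz.ge, eval_one, norm_inv]
    have h5 := hsb z hz
    have h6 : (1:ℝ) ≤ ‖1 + evalTF s z‖ + ‖evalTF s z‖ := by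
      have := norm_sub_le (1 + evalTF s z) (evalTF s z)
      simpa using this
    exact inv_anti₀ (by linarith) (by linarith)
  have hdN : ∀ {m : ℕ} (A : TMat m 1), A * (d * N) = s • A := fun A => by
    rw [mul_one_one, hs]
  have hD : IsUnit (1 + N * d).det := by
    rw [Matrix.det_one_add_mul_comm, Matrix.det_fin_one, Matrix.add_apply, Matrix.one_apply_eq, ← hs]
    exact isUnit_iff_ne_zero.2 h0
  rw [← hR'] at hM'
  rw [← hN'] at hL'
  obtain ⟨⟨k1, k2, k3, k4⟩, a3, a4⟩ := algebra_part (zIA (shiftMat n)) (rmap (e1 n))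
    (rmap (rowVec g)) d R M N L h1 h2 h3 h4 hR hD R' M' N' L' hR' hN' hM' hL'
  rw [← hgt] at k3 k4 a3 a4
  -- explicit forms
  have fN : N' = c • N := by
    have : (1 + N * d) * (c • N) = N := by
      rw [Matrix.mul_smul, Matrix.add_mul, Matrix.one_mul, Matrix.mul_assoc, hdN, smul_add,
        smul_smul, ← add_smul]
      rw [show c + c * s = 1 by rw [← hcs]; ring, one_smul]
    rw [hN']
    nth_rw 2 [← this]
    rw [Matrix.nonsing_inv_mul_cancel_left _ _ hD]
  have fR : R' = R - c • (N * (d * R)) := by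
    have : (1 + N * d) * (R - c • (N * (d * R))) = R := by
      have e : N * d * (N * (d * R)) = s • (N * (d * R)) := by
        rw [← Matrix.mul_assoc (N * d), Matrix.mul_assoc N d N, hdN, Matrix.smul_mul]
      rw [Matrix.mul_sub, Matrix.mul_smul, Matrix.add_mul, Matrix.one_mul, Matrix.add_mul,
        Matrix.one_mul, e, smul_add, smul_smul, ← add_smul,
        show c + c * s = 1 by rw [← hcs]; ring, one_smul, Matrix.mul_assoc]
      abel
    have e2 := congrArg ((1 + N * d)⁻¹ * ·) this
    simp only [Matrix.nonsing_inv_mul_cancel_left _ _ hD] at e2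
    rw [hR', ← e2]
  have fL : L' = c • L := by
    rw [hL', fN, Matrix.mul_smul, Matrix.mul_assoc, hdN, smul_smul]
    nth_rw 1 [← one_smul TF L]
    rw [← sub_smul, ← hcs]
    congr 1
    ring
  have fP : 1 + (rmap (rowVec gt) * N') 0 0 = c * (1 + (rmap (rowVec g) * N) 0 0) := by
    rw [fN, hgt, Matrix.mul_smul, Matrix.sub_mul, Matrix.smul_apply, Matrix.sub_apply, ← hs,
      smul_eq_mul]
    linear_combination -hcs
  -- stability of the perturbed response
  have mN' : ∀ i j, SP (N' i j) := by
    intro i j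
    rw [fN, Matrix.smul_apply, smul_eq_mul]
    exact SP_mul hcRH (mN i j)
  have mR' : ∀ i j, SP (R' i j) := by
    intro i j
    rw [fR, Matrix.sub_apply, Matrix.smul_apply, smul_eq_mul]
    exact SP_sub (mR i j) (SP_mul hcRH (SPmat_mul (fun i j => (mN i j).1) (SPmat_mul md mR) i j))
  have mM' : ∀ i j, SP (M' i j) := by
    intro i j
    rw [hM', Matrix.sub_apply]
    exact SP_sub (mM i j) (SPmat_mul (RHmat_mul mL md) mR' i j)
  have mL' : ∀ i j, L' i j ∈ RH := by
    intro i j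
    rw [fL, Matrix.smul_apply, smul_eq_mul]
    exact RH.mul_mem hcRH (mL i j)
  have hstab : SLSStable (⟨R', M', N', L'⟩ : Response n 1 1) :=
    ⟨fun i j => (sproper_iff _).2 (mR' i j).2, fun i j => (sproper_iff _).2 (mM' i j).2,
      fun i j => (sproper_iff _).2 (mN' i j).2, fun i j => mem_RH.1 (mR' i j).1,
      fun i j => mem_RH.1 (mM' i j).1, fun i j => mem_RH.1 (mN' i j).1,
      fun i j => mem_RH.1 (mL' i j)⟩
  have hach : Achieves (shiftMat n) (e1 n) (rowVec gt) (controller ⟨R, M, N, L⟩)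
      ⟨R', M', N', L'⟩ :=
    ⟨by rw [add_comm]; exact sub_eq_iff_eq_add.1 k1, sub_eq_zero.1 k2, a3, a4⟩
  -- norms
  have mgN : SP ((rmap (rowVec g) * N) 0 0) := SPmat_mul (rmap_RH _) mN 0 0
  have hP : 0 < perfWeight g ⟨R, M, N, L⟩ := perf_pos mgN (mL 0 0)
  have smulBound : ∀ {m : ℕ} (F F' : TMat m 1), (∀ i, StableTF (F i 0)) →
      (∀ i, F' i 0 = c * F i 0) → hinfNorm F' ≤ (1 - ε * hinfNorm N)⁻¹ * hinfNorm F := by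
    intro m F F' hF hFF
    apply hinf_le
    intro z hz
    rw [specNorm_smul (evalTF c z) (evalMat F z)]
    · exact mul_le_mul (hcb z hz) (le_hinf hF hz) (specNorm_nonneg _)
        (inv_nonneg.2 (by linarith))
    · intro i
      simp only [evalMat, Matrix.of_apply]
      rw [hFF, eval_mul (RH_stable hcRH) (hF i) hz.ge]
  have bN : hinfNorm N' ≤ (1 - ε * hinfNorm N)⁻¹ * hinfNorm N :=
    smulBound N N' sN (fun i => by rw [fN]; rfl)
  have bP : perfWeight gt ⟨R', M', N', L'⟩ ≤
      (1 - ε * hinfNorm N)⁻¹ * perfWeight g ⟨R, M, N, L⟩ := by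
    apply smulBound
    · intro i
      fin_cases i
      · exact RH_stable (RH.add_mem RH.one_mem mgN.1)
      · exact RH_stable (mL 0 0)
    · intro i
      fin_cases i
      · exact fP
      · change L' 0 0 = c * L 0 0
        rw [fL]; rfl
  have hα : 0 < (1 - 2 * ε * hinfNorm N)⁻¹ * perfWeight g ⟨R, M, N, L⟩ :=
    mul_pos (inv_pos.2 (by linarith)) hP
  refine ⟨hα, ⟨⟨_, hach, hstab⟩, hach⟩, ⟨k1, k2, k3, k4, hstab⟩, ?_⟩
  refine (add_le_add (mul_le_mul_of_nonneg_left bN (mul_nonneg hε0 hα.le)) bP).trans (le_of_eq ?_)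
  have arith : ∀ H P : ℝ, 1 - ε * H ≠ 0 → 1 - 2 * ε * H ≠ 0 →
      ε * ((1 - 2 * ε * H)⁻¹ * P) * ((1 - ε * H)⁻¹ * H) + (1 - ε * H)⁻¹ * P =
        (1 - 2 * ε * H)⁻¹ * P := by
    intro H P n1 n2
    have e1 := mul_inv_cancel₀ n1
    have e2 := mul_inv_cancel₀ n2
    linear_combination (1 - 2 * ε * H)⁻¹ * P * e1 - (1 - ε * H)⁻¹ * P * e2
  exact arith _ _ (by linarith) (by linarith)

end SLSAux


/-- feasibility lemma: with `Θ₀` satisfying the SLS constraints for the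
true plant `(Z, e₁, gᵀ)`, `R₀` invertible, `‖δ‖₂ ≤ ε` (`δ = g − g̃`) and
`ε < 1/(2‖N₀‖)`: (a) `α₀ := (1 − 2ε‖N₀‖)⁻¹‖[1 + gᵀN₀; L₀]‖ > 0`; (b) `K₀` internally
stabilizes the estimated plant `(Z, e₁, g̃ᵀ)` and achieves on it the response `Θ̂₀`
given by `(I + N₀δᵀ)⁻¹`-formulas; (c) `(Θ̂₀, α₀)` is feasible for the robust SLS
problem for `g̃` with uncertainty parameter `ε`. -/
theorem statement_10 (r nw : ℕ) (g gt : Fin (r - 1) → ℝ)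
    (B₁ : Matrix (Fin (r - 1)) (Fin nw) ℝ) (D₂₁ : Matrix (Fin 1) (Fin nw) ℝ)
    (D₁₁ : Matrix (Fin 2) (Fin nw) ℝ) (Θ₀ : Response (r - 1) 1 1) (ε : ℝ)
    (hsls : SLSConstraints (shiftMat (r - 1)) (e1 (r - 1)) (rowVec g) Θ₀)
    (hR : IsUnit Θ₀.R.det)
    (hδ : euclNorm (g - gt) ≤ ε)
    (hε : ε < 1 / (2 * hinfNorm Θ₀.N)) :
    0 < (1 - 2 * ε * hinfNorm Θ₀.N)⁻¹ * perfWeight g Θ₀ ∧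
    (InternallyStabilizes (shiftMat (r - 1)) (e1 (r - 1)) (rowVec gt) (controller Θ₀) ∧
      Achieves (shiftMat (r - 1)) (e1 (r - 1)) (rowVec gt) (controller Θ₀)
        (deltaPerturb (Θ₀.N * rmap (rowVec (g - gt))) (Θ₀.L * rmap (rowVec (g - gt))) Θ₀)) ∧
    SLSConstraints (shiftMat (r - 1)) (e1 (r - 1)) (rowVec gt)
      (deltaPerturb (Θ₀.N * rmap (rowVec (g - gt))) (Θ₀.L * rmap (rowVec (g - gt))) Θ₀) ∧
    ε * ((1 - 2 * ε * hinfNorm Θ₀.N)⁻¹ * perfWeight g Θ₀) *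
        hinfNorm (deltaPerturb (Θ₀.N * rmap (rowVec (g - gt)))
          (Θ₀.L * rmap (rowVec (g - gt))) Θ₀).N +
      perfWeight gt (deltaPerturb (Θ₀.N * rmap (rowVec (g - gt)))
        (Θ₀.L * rmap (rowVec (g - gt))) Θ₀) ≤
      (1 - 2 * ε * hinfNorm Θ₀.N)⁻¹ * perfWeight g Θ₀ := by
  exact SLSAux.main g gt Θ₀ ε hsls hR hδ hε _ rfl
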